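/- Let G be an n-vertex k-critical graph with k ≥ 4. If some edge of G is contained in exactly d copies of K_{k-1}, then t_{k-1}(G) ≤ n - (k - 2 - d). -/

import Mathlib

open SimpleGraph

/-- The number of copies of the clique `K_ℓ` in `G`: the number of `ℓ`-element
vertex subsets inducing a complete subgraph. -/
noncomputable def cliqueCount {V : Type*} (G : SimpleGraph V) (ℓ : ℕ) : ℕ :=
  {s : Finset V | G.IsNClique ℓ s}.ncard

/-- `G` is `k`-critical: its chromatic number is `k`, but every proper subgraph
has chromatic number less than `k`. -/
def IsCritical {V : Type*} (G : SimpleGraph V) (k : ℕ) : Prop :=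
  G.chromaticNumber = k ∧ ∀ H : G.Subgraph, H ≠ ⊤ → H.coe.chromaticNumber < k

lemma IsCritical.not_colorable {V : Type*} {G : SimpleGraph V} {k : ℕ} (hk : 1 ≤ k)
    (hG : IsCritical G k) : ¬ G.Colorable (k - 1) := by
  intro h
  have h' := h.chromaticNumber_le
  rw [hG.1] at h'
  have : k ≤ k - 1 := by exact_mod_cast h'
  omega

/-- Deleting an edge of a `k`-critical graph leaves a graph with a surjective `(k - 1)`-coloring
which gives both ends of that edge the same color. -/
lemma IsCritical.exists_coloring {V : Type*} {G : SimpleGraph V} {k : ℕ} (hk : 1 ≤ k)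
    (hG : IsCritical G k) {x y : V} (hxy : G.Adj x y) :
    ∃ c : V → Fin (k - 1), c x = c y ∧
      (∀ a b, G.Adj a b → s(a, b) ≠ s(x, y) → c a ≠ c b) ∧ Function.Surjective c := by
  classical
  have hcol : ∃ c : V → Fin (k - 1), ∀ a b, G.Adj a b → s(a, b) ≠ s(x, y) → c a ≠ c b := by
    let H : G.Subgraph := (⊤ : G.Subgraph).deleteEdges {s(x, y)}
    have hH : H ≠ ⊤ := by
      intro h
      have hadj : H.Adj x y := by rw [h]; exact hxy
      simp [H] at hadj
    have hlt := hG.2 H hH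
    have hcH : H.coe.Colorable (k - 1) := by
      obtain ⟨m, hm⟩ := ENat.ne_top_iff_exists.mp (ne_top_of_lt hlt)
      rw [← hm] at hlt
      have hmk : m < k := by exact_mod_cast hlt
      have hle : H.coe.chromaticNumber ≤ ((k - 1 : ℕ) : ℕ∞) := by
        rw [← hm]
        exact_mod_cast (by omega : m ≤ k - 1)
      exact chromaticNumber_le_iff_colorable.mp hle
    obtain ⟨C⟩ := hcH
    refine ⟨fun a => C ⟨a, by simp [H]⟩, fun a b hab hne => C.valid ?_⟩
    rw [Subgraph.coe_adj, Subgraph.deleteEdges_adj]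
    exact ⟨hab, hne⟩
  obtain ⟨c, hc⟩ := hcol
  have hnot := hG.not_colorable hk
  have hsame : c x = c y := by
    by_contra hne
    refine hnot ⟨Coloring.mk c fun {a b} hab => ?_⟩
    by_cases h : s(a, b) = s(x, y)
    · rcases Sym2.eq_iff.mp h with ⟨rfl, rfl⟩ | ⟨rfl, rfl⟩
      · exact hne
      · exact fun h => hne h.symm
    · exact hc a b hab h
  refine ⟨c, hsame, hc, fun i => ?_⟩
  by_contra! hi
  refine hnot ⟨Coloring.mk (Function.update c x i) fun {a b} hab => ?_⟩
  have hne := hab.ne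
  by_cases ha : a = x
  · subst ha
    rw [Function.update_self, Function.update_of_ne hne.symm]
    exact (hi b).symm
  · rw [Function.update_of_ne ha]
    by_cases hb : b = x
    · subst hb
      rw [Function.update_self]
      exact hi a
    · rw [Function.update_of_ne hb]
      refine hc a b hab fun h => ?_
      rcases Sym2.eq_iff.mp h with ⟨h1, -⟩ | ⟨-, h2⟩
      exacts [ha h1, hb h2]

/-- A `q`-clique avoiding the exceptional edge meets each of `q` color classes exactly once. -/
lemma card_filter_color_eq_one {V : Type*} [DecidableEq V] {G : SimpleGraph V} {q : ℕ} {x y : V}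
    {c : V → Fin q} (hc : ∀ a b, G.Adj a b → s(a, b) ≠ s(x, y) → c a ≠ c b)
    {T : Finset V} (hT : G.IsNClique q T) (hxy : ¬ (x ∈ T ∧ y ∈ T)) (i : Fin q) :
    (T.filter (c · = i)).card = 1 := by
  have hinj : Set.InjOn c T := by
    intro a ha b hb hab
    by_contra hne
    refine hc a b (hT.isClique ha hb hne) (fun h => hxy ?_) hab
    rcases Sym2.eq_iff.mp h with ⟨rfl, rfl⟩ | ⟨rfl, rfl⟩
    exacts [⟨ha, hb⟩, ⟨hb, ha⟩]
  have himg : T.image c = Finset.univ := by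
    apply Finset.eq_univ_of_card
    rw [Finset.card_image_of_injOn hinj, hT.card_eq, Fintype.card_fin]
  obtain ⟨w, hw, rfl⟩ := Finset.mem_image.mp (himg ▸ Finset.mem_univ i)
  rw [Finset.card_eq_one]
  refine ⟨w, ?_⟩
  ext z
  simp only [Finset.mem_filter, Finset.mem_singleton]
  exact ⟨fun h => hinj h.1 hw h.2, fun h => by subst h; exact ⟨hw, rfl⟩⟩

/-- A clique containing the exceptional edge meets the color class of its ends exactly twice. -/
lemma card_filter_color_eq_two {V : Type*} [DecidableEq V] {G : SimpleGraph V} {q : ℕ} {x y : V}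
    (hadj : G.Adj x y) {c : V → Fin q} (hsame : c x = c y)
    (hc : ∀ a b, G.Adj a b → s(a, b) ≠ s(x, y) → c a ≠ c b)
    {T : Finset V} (hT : G.IsClique T) (hx : x ∈ T) (hy : y ∈ T) :
    (T.filter (c · = c x)).card = 2 := by
  rw [Finset.card_eq_two]
  refine ⟨x, y, hadj.ne, ?_⟩
  ext z
  simp only [Finset.mem_filter, Finset.mem_insert, Finset.mem_singleton]
  constructor
  · rintro ⟨hz, hzc⟩
    by_contra! hne
    refine hc z x (hT hz hx hne.1) (fun h => ?_) hzc
    rcases Sym2.eq_iff.mp h with ⟨h1, -⟩ | ⟨h1, -⟩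
    exacts [hne.1 h1, hne.2 h1]
  · rintro (rfl | rfl)
    exacts [⟨hx, rfl⟩, ⟨hy, hsame.symm⟩]

/-- If a rational combination of the incidence vectors of the `(k - 1)`-cliques of a `k`-critical
graph vanishes, then so does the sum of the coefficients of the cliques containing any given set. -/
lemma IsCritical.sum_superset_eq_zero {V : Type*} [Fintype V] [DecidableEq V] {G : SimpleGraph V}
    {k : ℕ} (hk : 2 ≤ k) (hG : IsCritical G k) (F : Finset (Finset V))
    (hF : ∀ T ∈ F, G.IsNClique (k - 1) T) (a : Finset V → ℚ)
    (h : ∀ v, ∑ T ∈ F with v ∈ T, a T = 0) (R : Finset V) :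
    ∑ T ∈ F with R ⊆ T, a T = 0 := by
  have hswap : ∀ A B : Finset V, ∑ v ∈ B, ∑ T ∈ F with insert v A ⊆ T, a T
      = ∑ T ∈ F with A ⊆ T, a T * ((T ∩ B).card : ℚ) := by
    intro A B
    simp only [Finset.sum_filter]
    rw [Finset.sum_comm]
    refine Finset.sum_congr rfl fun T _ => ?_
    by_cases hA : A ⊆ T
    · simp only [Finset.insert_subset_iff, hA, and_true, if_true]
      rw [← Finset.sum_filter, Finset.sum_const, nsmul_eq_mul, mul_comm,
        Finset.filter_mem_eq_inter, Finset.inter_comm]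
    · simp [Finset.insert_subset_iff, hA]
  induction hn : R.card using Nat.strong_induction_on generalizing R with
  | _ m ih =>
  rcases R.eq_empty_or_nonempty with rfl | ⟨x, hx⟩
  · have h1 := hswap ∅ Finset.univ
    simp only [insert_empty_eq, Finset.singleton_subset_iff, h, Finset.sum_const_zero,
      Finset.inter_univ] at h1
    rw [Finset.sum_congr rfl (g := fun T => a T * ((k - 1 : ℕ) : ℚ)) fun T hT => by
      rw [(hF T (Finset.mem_filter.mp hT).1).card_eq], ← Finset.sum_mul] at h1
    rcases mul_eq_zero.mp h1.symm with h2 | h2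
    · exact h2
    · have : k - 1 = 0 := by exact_mod_cast h2
      omega
  by_cases hR : ∃ y ∈ R, y ≠ x
  swap
  · push Not at hR
    obtain rfl : R = {x} := Finset.eq_singleton_iff_unique_mem.mpr ⟨hx, hR⟩
    simpa using h x
  obtain ⟨y, hy, hyx⟩ := hR
  by_cases hadj : G.Adj x y
  swap
  · refine Finset.sum_eq_zero fun T hT => ?_
    rw [Finset.mem_filter] at hT
    exact absurd ((hF T hT.1).isClique (hT.2 hx) (hT.2 hy) hyx.symm) hadj
  obtain ⟨c, hsame, hc, -⟩ := hG.exists_coloring (by omega) hadj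
  set A := (R.erase x).erase y with hA
  have hyA : y ∈ R.erase x := Finset.mem_erase.mpr ⟨hyx, hy⟩
  have hcA : A.card + 2 = m := by
    have h1 := Finset.card_erase_add_one hyA
    rw [← hA] at h1
    have h2 := Finset.card_erase_add_one hx
    omega
  have hz : ∑ v ∈ Finset.univ.filter (c · = c x), ∑ T ∈ F with insert v A ⊆ T, a T = 0 := by
    refine Finset.sum_eq_zero fun v _ => ih _ ?_ (insert v A) rfl
    have := Finset.card_insert_le v A
    omega
  have hRA : ∀ T, R ⊆ T ↔ A ⊆ T ∧ x ∈ T ∧ y ∈ T := by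
    intro T
    rw [← Finset.insert_erase hx, ← Finset.insert_erase hyA]
    simp only [Finset.insert_subset_iff, ← hA]
    tauto
  have hsplit : ∑ T ∈ F with A ⊆ T, a T * ((T ∩ Finset.univ.filter (c · = c x)).card : ℚ)
      = ∑ T ∈ F with A ⊆ T, a T + ∑ T ∈ F with R ⊆ T, a T := by
    simp only [Finset.sum_filter]
    rw [← Finset.sum_add_distrib]
    refine Finset.sum_congr rfl fun T hT => ?_
    have hcap : T ∩ Finset.univ.filter (c · = c x) = T.filter (c · = c x) := by
      ext; simp
    rw [hcap]
    by_cases hAT : A ⊆ T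
    · by_cases hxyT : x ∈ T ∧ y ∈ T
      · rw [if_pos hAT, if_pos hAT, if_pos ((hRA T).mpr ⟨hAT, hxyT⟩),
          card_filter_color_eq_two hadj hsame hc (hF T hT).isClique hxyT.1 hxyT.2]
        push_cast
        ring
      · rw [if_pos hAT, if_pos hAT, if_neg fun hRT => hxyT ((hRA T).mp hRT).2,
          card_filter_color_eq_one hc (hF T hT) hxyT]
        simp
    · rw [if_neg hAT, if_neg hAT, if_neg fun hRT => hAT ((hRA T).mp hRT).1, add_zero]
  rw [hswap, hsplit, ih _ (by omega) A rfl, zero_add] at hz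
  exact hz

/-- The incidence vectors of the `(k - 1)`-cliques of a `k`-critical graph are linearly
independent. -/
lemma IsCritical.linearIndependent_cliques {V : Type*} [Fintype V] [DecidableEq V]
    {G : SimpleGraph V} {k : ℕ} (hk : 2 ≤ k) (hG : IsCritical G k) (F : Finset (Finset V))
    (hF : ∀ T ∈ F, G.IsNClique (k - 1) T) :
    LinearIndependent ℚ (fun (T : F) (v : V) => if v ∈ T.1 then (1 : ℚ) else 0) := by
  rw [Fintype.linearIndependent_iff]
  intro g hg T₀
  let a : Finset V → ℚ := fun T => if hT : T ∈ F then g ⟨T, hT⟩ else 0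
  have ha : ∀ T : F, a T = g T := fun T => by simp [a]
  have h : ∀ v, ∑ T ∈ F with v ∈ T, a T = 0 := by
    intro v
    have hv := congrFun hg v
    rw [Finset.sum_filter, ← Finset.sum_coe_sort]
    simpa [ha] using hv
  have hs := hG.sum_superset_eq_zero hk F hF a h T₀.1
  rw [Finset.sum_eq_single T₀.1, ha] at hs
  · exact hs
  · intro T hT hne
    rw [Finset.mem_filter] at hT
    refine absurd (Finset.eq_of_subset_of_card_le hT.2 ?_).symm hne
    rw [(hF T hT.1).card_eq, (hF T₀.1 T₀.2).card_eq]
  · intro hT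
    simp [T₀.2] at hT

/-- In a `k`-critical graph on `n` vertices, at most `n - (k - 2)` of the `(k - 1)`-cliques avoid
any given edge. -/
lemma IsCritical.card_cliques_avoiding_edge {V : Type*} [Fintype V] [DecidableEq V]
    {G : SimpleGraph V} {k : ℕ} (hk : 2 ≤ k) (hG : IsCritical G k) {u v : V} (huv : G.Adj u v)
    (F : Finset (Finset V)) (hF : ∀ T ∈ F, G.IsNClique (k - 1) T)
    (huvF : ∀ T ∈ F, ¬ (u ∈ T ∧ v ∈ T)) :
    F.card + (k - 2) ≤ Fintype.card V := by
  obtain ⟨c, -, hc, hsurj⟩ := hG.exists_coloring (by omega) huv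
  obtain ⟨r, hr⟩ := hsurj.hasRightInverse
  let ψ : (V → ℚ) →ₗ[ℚ] ({i // i ≠ c u} → ℚ) :=
    { toFun := fun f i => ∑ w with c w = i.1, f w - ∑ w with c w = c u, f w
      map_add' := fun f g => by
        ext i
        simp only [Pi.add_apply, Finset.sum_add_distrib]
        ring
      map_smul' := fun q f => by
        ext i
        simp only [Pi.smul_apply, smul_eq_mul, ← Finset.mul_sum, RingHom.id_apply]
        ring }
  have hψ_apply : ∀ f i, ψ f i = ∑ w with c w = i.1, f w - ∑ w with c w = c u, f w :=
    fun _ _ => rfl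
  have hψ : Function.Surjective ψ := by
    intro g
    let g' : Fin (k - 1) → ℚ := fun i => if hi : i ≠ c u then g ⟨i, hi⟩ else 0
    have hsum : ∀ i, ∑ w with c w = i, (if w = r (c w) then g' (c w) else 0) = g' i := by
      intro i
      rw [Finset.sum_eq_single (r i)]
      · simp [hr i]
      · intro w hw hne
        rw [Finset.mem_filter] at hw
        rw [hw.2, if_neg hne]
      · intro h
        simp [hr i] at h
    refine ⟨fun w => if w = r (c w) then g' (c w) else 0, ?_⟩
    ext i
    rw [hψ_apply, hsum, hsum]
    simp [g', i.2]
  have hli := hG.linearIndependent_cliques hk F hF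
  have hle : Submodule.span ℚ (Set.range fun (T : F) (w : V) => if w ∈ T.1 then (1 : ℚ) else 0)
      ≤ LinearMap.ker ψ := by
    rw [Submodule.span_le]
    rintro _ ⟨T, rfl⟩
    have hone : ∀ i, ∑ w with c w = i, (if w ∈ T.1 then (1 : ℚ) else 0) = 1 := by
      intro i
      have h1 := card_filter_color_eq_one hc (hF T.1 T.2) (huvF T.1 T.2) i
      rw [Finset.sum_boole, Finset.filter_filter]
      rw [show Finset.univ.filter (fun w => c w = i ∧ w ∈ T.1) = T.1.filter (c · = i) by
        ext; simp [and_comm], h1, Nat.cast_one]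
    rw [SetLike.mem_coe, LinearMap.mem_ker]
    ext i
    rw [hψ_apply, hone, hone]
    simp
  have h1 := Submodule.finrank_mono hle
  rw [finrank_span_eq_card hli, Fintype.card_coe] at h1
  have h2 := LinearMap.finrank_range_add_finrank_ker ψ
  rw [LinearMap.range_eq_top.mpr hψ, finrank_top, Module.finrank_fintype_fun_eq_card,
    Module.finrank_fintype_fun_eq_card, Fintype.card_subtype_compl, Fintype.card_fin,
    Fintype.card_subtype_eq] at h2
  omega

/-- Kézdy–Snevily: if some edge of an `n`-vertex `k`-critical graph `G` lies in
exactly `d` copies of `K_{k-1}`, then `t_{k-1}(G) ≤ n - (k - 2 - d)`. -/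
theorem edge_clique_count_bound {V : Type*} [Fintype V] {n k d : ℕ} (hk : 4 ≤ k)
    (hcard : Fintype.card V = n) (G : SimpleGraph V) (hG : IsCritical G k)
    (u v : V) (huv : G.Adj u v)
    (hd : {s : Finset V | G.IsNClique (k - 1) s ∧ u ∈ s ∧ v ∈ s}.ncard = d) :
    (cliqueCount G (k - 1) : ℤ) ≤ (n : ℤ) - ((k : ℤ) - 2 - d) := by
  classical
  have hsplit := Finset.card_filter_add_card_filter_not
    (s := Finset.univ.filter fun s : Finset V => G.IsNClique (k - 1) s)
    (fun s => u ∈ s ∧ v ∈ s)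
  have hbound := hG.card_cliques_avoiding_edge (by omega) huv
    ((Finset.univ.filter fun s : Finset V => G.IsNClique (k - 1) s).filter
      fun s => ¬ (u ∈ s ∧ v ∈ s))
    (fun T hT => (Finset.mem_filter.mp (Finset.mem_filter.mp hT).1).2)
    (fun T hT => (Finset.mem_filter.mp hT).2)
  have ht : cliqueCount G (k - 1)
      = (Finset.univ.filter fun s : Finset V => G.IsNClique (k - 1) s).card := by
    rw [cliqueCount, ← Set.ncard_coe_finset]
    simp
  have hd' : ((Finset.univ.filter fun s : Finset V => G.IsNClique (k - 1) s).filter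
      fun s => u ∈ s ∧ v ∈ s).card = d := by
    rw [← hd, ← Set.ncard_coe_finset]
    congr 1
    ext s
    simp
  omega
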